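/- For every 0 < β < 1, every x > 0 and every real s > 0, the Laplace transform of t ↦ g_β(x;t) satisfies ∫_0^∞ e^{−s t} g_β(x;t) dt = s^{β−1} e^{−x s^β}. -/

import Mathlib

open MeasureTheory Real Set Filter

/-- The Wright-type density `g_β(x;t) = t^{-β} ∑_{k} (−x/t^β)^k / (k! Γ(1 − β(k+1)))`. -/
noncomputable def wrightG (β x t : ℝ) : ℝ :=
  t ^ (-β) * ∑' k : ℕ, (-x / t ^ β) ^ k / ((Nat.factorial k : ℝ) * Real.Gamma (1 - β * (k + 1)))

/-- The two-parameter Mittag-Leffler function `E_{β,α}(z) = ∑_k z^k / Γ(βk + α)`. -/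
noncomputable def mittagLeffler (β α z : ℝ) : ℝ :=
  ∑' k : ℕ, z ^ k / Real.Gamma (β * k + α)

/-- The Caputo fractional derivative of order `β ∈ (0,1)`:
`D_c^β h(t) = (1/Γ(1−β)) ∫_0^t (t−τ)^{−β} h′(τ) dτ`. -/
noncomputable def caputo (β : ℝ) (h : ℝ → ℝ) (t : ℝ) : ℝ :=
  (1 / Real.Gamma (1 - β)) * ∫ τ in (0:ℝ)..t, (t - τ) ^ (-β) * deriv h τ

/-- A function is of exponential order on `[0,∞)` if `|h(x)| ≤ C e^{a x}` there. -/
def ExpOrder (h : ℝ → ℝ) : Prop :=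
  ∃ C a : ℝ, 0 < C ∧ 0 < a ∧ ∀ x : ℝ, 0 ≤ x → |h x| ≤ C * Real.exp (a * x)

open scoped Topology Interval

/-- Substitution `r = exp u`: integrability. -/
theorem integrable_exp_smul_comp_exp {f : ℝ → ℂ} (hf : IntegrableOn f (Ioi 0)) :
    Integrable fun u : ℝ => Real.exp u • f (Real.exp u) := by
  have h := (integrableOn_image_iff_integrableOn_abs_deriv_smul (s := univ) (f := Real.exp)
    MeasurableSet.univ (fun u _ => (Real.hasDerivAt_exp u).hasDerivWithinAt)
    Real.exp_injective.injOn f).1 (by simpa [Set.image_univ, Real.range_exp] using hf)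
  simpa [abs_of_pos (Real.exp_pos _), integrableOn_univ] using h

/-- Substitution `r = exp u`: value of the integral. -/
theorem integral_exp_smul_comp_exp (f : ℝ → ℂ) :
    ∫ u : ℝ, Real.exp u • f (Real.exp u) = ∫ r in Ioi (0 : ℝ), f r := by
  have h := integral_image_eq_integral_abs_deriv_smul (s := univ) (f := Real.exp)
    MeasurableSet.univ (fun u _ => (Real.hasDerivAt_exp u).hasDerivWithinAt)
    Real.exp_injective.injOn f
  simpa [Set.image_univ, Real.range_exp, abs_of_pos (Real.exp_pos _)] using h.symm

/-- Cauchy's theorem on a horizontal strip for a function that is small on the vertical sides. -/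
theorem tendsto_integral_sub_integral_add_mul_I {f : ℂ → ℂ} {η : ℝ}
    (hf : DifferentiableOn ℂ f {z | z.im ∈ [[0, η]]}) {b : ℝ → ℝ}
    (htop : ∀ᶠ r in atTop, ∀ y ∈ [[0, η]], ‖f ((r : ℝ) + (y : ℝ) * Complex.I)‖ ≤ b r)
    (hbot : ∀ᶠ r in atBot, ∀ y ∈ [[0, η]], ‖f ((r : ℝ) + (y : ℝ) * Complex.I)‖ ≤ b r)
    (hb_top : Tendsto b atTop (𝓝 0)) (hb_bot : Tendsto b atBot (𝓝 0)) :
    Tendsto (fun r : ℝ => (∫ u in -r..r, f (u : ℝ)) - ∫ u in -r..r, f ((u : ℝ) + η * Complex.I))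
      atTop (𝓝 0) := by
  have hside : ∀ r : ℝ, (∀ y ∈ [[0, η]], ‖f (r + (y : ℝ) * Complex.I)‖ ≤ b r) →
      ‖∫ y in (0 : ℝ)..η, f (r + (y : ℝ) * Complex.I)‖ ≤ b r * |η| := fun r h => by
    simpa using intervalIntegral.norm_integral_le_of_norm_le_const
      (fun y hy => h y (uIoc_subset_uIcc hy))
  have hlim : Tendsto (fun r => b r * |η| + b (-r) * |η|) atTop (𝓝 0) := by
    simpa using (hb_top.mul_const |η|).add ((hb_bot.comp tendsto_neg_atTop_atBot).mul_const |η|)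
  refine squeeze_zero_norm' ?_ hlim
  filter_upwards [htop, tendsto_neg_atTop_atBot.eventually hbot] with r hr hr'
  have h := Complex.integral_boundary_rect_eq_zero_of_differentiableOn f (-r : ℝ)
    ((r : ℝ) + (η : ℝ) * Complex.I) (hf.mono fun z hz => by simpa using hz.2)
  simp only [Complex.ofReal_re, Complex.ofReal_im, Complex.add_re, Complex.add_im, Complex.mul_re,
    Complex.mul_im, Complex.I_re, Complex.I_im, mul_zero, mul_one, zero_mul, sub_zero, add_zero,
    zero_add, Complex.ofReal_zero, smul_eq_mul] at h
  have h' : (∫ u in -r..r, f (u : ℝ)) - ∫ u in -r..r, f ((u : ℝ) + η * Complex.I)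
      = Complex.I * (∫ y in (0 : ℝ)..η, f ((-r : ℝ) + (y : ℝ) * Complex.I))
        - Complex.I * (∫ y in (0 : ℝ)..η, f ((r : ℝ) + (y : ℝ) * Complex.I)) := by
    linear_combination h
  rw [h']
  refine (norm_sub_le _ _).trans ?_
  rw [norm_mul, norm_mul, Complex.norm_I, one_mul, one_mul, add_comm]
  exact add_le_add (hside r hr) (hside (-r) hr')

theorem integrable_exp_mul_exp_neg_mul_exp {a b : ℝ} (ha : 0 < a) (hb : 0 < b) :
    Integrable fun u : ℝ => Real.exp (a * u) * Real.exp (-b * Real.exp u) := by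
  have h0 := integrableOn_rpow_mul_exp_neg_mul_rpow (p := 1) (s := a - 1) (b := b)
    (by linarith) one_pos hb
  have h := (integrable_exp_smul_comp_exp h0.ofReal).re
  refine h.congr (.of_forall fun u => ?_)
  simp only [Real.rpow_one, RCLike.smul_re, RCLike.ofReal_re]
  rw [← mul_assoc, ← Real.exp_mul, ← Real.exp_add]
  congr 2
  ring

theorem tendsto_exp_mul_mul_exp_neg_mul_exp_atTop (a : ℝ) {b : ℝ} (hb : 0 < b) :
    Tendsto (fun u : ℝ => Real.exp (a * u) * Real.exp (-b * Real.exp u)) atTop (𝓝 0) := by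
  refine ((tendsto_rpow_mul_exp_neg_mul_atTop_nhds_zero a b hb).comp
    Real.tendsto_exp_atTop).congr fun u => ?_
  simp only [Function.comp_apply, ← Real.exp_mul, mul_comm u a]

theorem tendsto_exp_mul_mul_exp_neg_mul_exp_atBot {a b : ℝ} (ha : 0 < a) (hb : 0 < b) :
    Tendsto (fun u : ℝ => Real.exp (a * u) * Real.exp (-b * Real.exp u)) atBot (𝓝 0) := by
  refine squeeze_zero (fun u => by positivity) (g := fun u => Real.exp (a * u)) (fun u => ?_)
    (Real.tendsto_exp_atBot.comp (tendsto_id.const_mul_atBot ha))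
  refine mul_le_of_le_one_right (Real.exp_pos _).le (Real.exp_le_one_iff.2 ?_)
  have : 0 < b * Real.exp u := by positivity
  linarith

theorem norm_cexp_mul_mul_cexp_neg_mul_cexp (a t u y : ℝ) :
    ‖Complex.exp (a * (u + y * Complex.I)) * Complex.exp (-t * Complex.exp (u + y * Complex.I))‖
      = Real.exp (a * u) * Real.exp (-(t * Real.cos y) * Real.exp u) := by
  rw [norm_mul, Complex.norm_exp, Complex.norm_exp]
  congr 2
  · simp
  · simp [Complex.exp_re]
    ring

theorem integral_cexp_mul_cexp_neg_mul_exp {a t : ℝ} (ha : 0 < a) (ht : 0 < t) :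
    ∫ u : ℝ, Complex.exp (a * u) * Complex.exp (-t * Complex.exp u)
      = ((1 / t) ^ a * Real.Gamma a : ℝ) := by
  rw [← Real.integral_rpow_mul_exp_neg_mul_Ioi ha ht, ← integral_complex_ofReal,
    ← integral_exp_smul_comp_exp]
  refine integral_congr_ae (.of_forall fun u => ?_)
  simp only [Complex.real_smul, ← Real.exp_mul]
  push_cast
  rw [← Complex.exp_add, ← Complex.exp_add, ← Complex.exp_add]
  ring_nf

/-- Euler's integral for the Gamma function along the rotated ray of argument `y`. -/
theorem integral_cexp_mul_cexp_neg_mul_exp_add_mul_I {a t y : ℝ} (ha : 0 < a) (ht : 0 < t)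
    (hy : |y| < π / 2) :
    ∫ u : ℝ, Complex.exp (a * (u + y * Complex.I))
        * Complex.exp (-t * Complex.exp (u + y * Complex.I))
      = ((1 / t) ^ a * Real.Gamma a : ℝ) := by
  have hcos : 0 < Real.cos y := Real.cos_pos_of_mem_Ioo (abs_lt.1 hy)
  have hint : ∀ y' : ℝ, 0 < Real.cos y' →
      Integrable fun u : ℝ => Complex.exp (a * (u + y' * Complex.I))
        * Complex.exp (-t * Complex.exp (u + y' * Complex.I)) := fun y' h => by
    refine (integrable_exp_mul_exp_neg_mul_exp ha (mul_pos ht h)).mono'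
      (by fun_prop) (.of_forall fun u => ?_)
    rw [norm_cexp_mul_mul_cexp_neg_mul_cexp]
  have hbound : ∀ r : ℝ, ∀ y' ∈ [[0, y]],
      ‖Complex.exp (a * (r + (y' : ℝ) * Complex.I))
        * Complex.exp (-t * Complex.exp (r + (y' : ℝ) * Complex.I))‖
      ≤ Real.exp (a * r) * Real.exp (-(t * Real.cos y) * Real.exp r) := fun r y' hy' => by
    rw [norm_cexp_mul_mul_cexp_neg_mul_cexp]
    have : Real.cos y ≤ Real.cos y' := by
      rw [← Real.cos_abs y, ← Real.cos_abs y']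
      refine Real.cos_le_cos_of_nonneg_of_le_pi (abs_nonneg _) (by linarith [pi_pos]) ?_
      simpa using abs_sub_left_of_mem_uIcc hy'
    gcongr
  have hlim := tendsto_integral_sub_integral_add_mul_I (η := y)
    (f := fun z => Complex.exp (a * z) * Complex.exp (-t * Complex.exp z))
    (by fun_prop) (.of_forall hbound) (.of_forall hbound)
    (tendsto_exp_mul_mul_exp_neg_mul_exp_atTop a (mul_pos ht hcos))
    (tendsto_exp_mul_mul_exp_neg_mul_exp_atBot ha (mul_pos ht hcos))
  have h0 : Integrable fun u : ℝ => Complex.exp (a * u) * Complex.exp (-t * Complex.exp u) := by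
    simpa using hint 0 (by simp)
  have hlim' := (intervalIntegral_tendsto_integral h0 tendsto_neg_atTop_atBot tendsto_id).sub
    (intervalIntegral_tendsto_integral (hint y hcos) tendsto_neg_atTop_atBot tendsto_id)
  rw [← integral_cexp_mul_cexp_neg_mul_exp ha ht]
  exact (sub_eq_zero.1 (tendsto_nhds_unique hlim' hlim)).symm

theorem exists_mul_exp_le_mul_exp_add {β x ε : ℝ} (hβ0 : 0 < β) (hβ1 : β < 1) (hx : 0 < x)
    (hε : 0 < ε) : ∃ C, ∀ u : ℝ, x * Real.exp (β * u) ≤ ε * Real.exp u + C := by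
  set u₀ := Real.log (x / ε) / (1 - β)
  refine ⟨x * Real.exp (β * u₀), fun u => ?_⟩
  rcases le_total u u₀ with h | h
  · have : x * Real.exp (β * u) ≤ x * Real.exp (β * u₀) := by gcongr
    have := mul_pos hε (Real.exp_pos u)
    linarith
  · have h1 : Real.log (x / ε) ≤ (1 - β) * u := by
      rw [div_le_iff₀ (by linarith)] at h
      linarith
    have h2 : x ≤ ε * Real.exp ((1 - β) * u) := by
      rw [Real.log_le_iff_le_exp (by positivity), div_le_iff₀ hε] at h1
      linarith
    have h3 : x * Real.exp (β * u) ≤ ε * Real.exp u :=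
      calc x * Real.exp (β * u) ≤ ε * Real.exp ((1 - β) * u) * Real.exp (β * u) := by gcongr
        _ = ε * Real.exp u := by rw [mul_assoc, ← Real.exp_add]; congr 2; ring
    have : 0 < x * Real.exp (β * u₀) := by positivity
    linarith

theorem integrable_exp_div_add_mul_exp {β s c : ℝ} (hβ0 : 0 < β) (hβ1 : β < 1) (hs : 0 < s)
    (hc : 0 < c) : Integrable fun u : ℝ => Real.exp (β * u) / (s + c * Real.exp u) := by
  have hcont : Continuous fun u : ℝ => Real.exp (β * u) / (s + c * Real.exp u) := by
    refine Continuous.div (by fun_prop) (by fun_prop) fun u => ?_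
    positivity
  rw [← integrableOn_univ, ← Iic_union_Ioi (a := (0 : ℝ)), integrableOn_union]
  constructor
  · refine Integrable.mono' ((integrableOn_exp_mul_Iic hβ0 0).div_const s)
      hcont.aestronglyMeasurable (.of_forall fun u => ?_)
    rw [Real.norm_of_nonneg (by positivity)]
    gcongr
    have : 0 < c * Real.exp u := by positivity
    linarith
  · refine Integrable.mono' ((integrableOn_exp_mul_Ioi (a := β - 1) (by linarith) 0).div_const c)
      hcont.aestronglyMeasurable (.of_forall fun u => ?_)
    rw [Real.norm_of_nonneg (by positivity), div_le_div_iff₀ (by positivity) hc,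
      show β * u = (β - 1) * u + u by ring, Real.exp_add]
    have : 0 < Real.exp ((β - 1) * u) * s := by positivity
    nlinarith

theorem one_div_Gamma_one_sub {a : ℝ} (ha : 0 < a) :
    1 / Real.Gamma (1 - a) = Real.Gamma a * Real.sin (π * a) / π := by
  have h := Real.Gamma_mul_Gamma_one_sub a
  by_cases hsin : Real.sin (π * a) = 0
  · rw [hsin, div_zero, mul_eq_zero] at h
    simp [h.resolve_left (Real.Gamma_pos_of_pos ha).ne', hsin]
  · have h1 : Real.Gamma (1 - a) ≠ 0 := by
      intro h0
      rw [h0, mul_zero] at h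
      exact absurd h.symm (div_ne_zero pi_ne_zero hsin)
    field_simp
    rw [eq_div_iff hsin] at h
    rw [mul_comm a π]
    linarith

/-- The function `F z = z ^ β * exp (-x * z ^ β)` on the ray of argument `θ / β`, in the
coordinate `u = log |z|`. -/
noncomputable def wrightKernel (β x θ u : ℝ) : ℂ :=
  Complex.exp (β * u + θ * Complex.I) * Complex.exp (-x * Complex.exp (β * u + θ * Complex.I))

theorem continuous_wrightKernel (β x θ : ℝ) : Continuous (wrightKernel β x θ) := by
  unfold wrightKernel
  fun_prop

theorem norm_wrightKernel_le {β x θ : ℝ} (hx : 0 < x) (hθ : |θ| < π / 2) (u : ℝ) :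
    ‖wrightKernel β x θ u‖ ≤ Real.exp (β * u) := by
  have hcos : 0 < Real.cos θ := Real.cos_pos_of_mem_Ioo (abs_lt.1 hθ)
  rw [wrightKernel, norm_mul, Complex.norm_exp, Complex.norm_exp]
  refine (mul_le_of_le_one_right (Real.exp_pos _).le (Real.exp_le_one_iff.2 ?_)).trans_eq ?_
  · have : 0 < x * (Real.exp (β * u) * Real.cos θ) := by positivity
    simpa [Complex.exp_re] using this.le
  · simp

theorem norm_cexp_neg_mul_cexp (t u θ : ℝ) :
    ‖Complex.exp (-t * Complex.exp (u + (-θ : ℝ) * Complex.I))‖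
      = Real.exp (-(t * Real.cos θ) * Real.exp u) := by
  simpa using norm_cexp_mul_mul_cexp_neg_mul_cexp 0 t u (-θ)

theorem hasSum_wrightKernel (β x θ u : ℝ) :
    HasSum (fun k : ℕ => ((-x) ^ k / (k.factorial : ℝ) : ℝ)
      * Complex.exp (β * u + θ * Complex.I) ^ (k + 1)) (wrightKernel β x θ u) := by
  have h := (NormedSpace.expSeries_div_hasSum_exp
    (-x * Complex.exp (β * u + θ * Complex.I))).mul_left (Complex.exp (β * u + θ * Complex.I))
  rw [← Complex.exp_eq_exp_ℂ] at h
  refine h.congr_fun fun k => ?_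
  push_cast
  ring

theorem integral_wrightKernel_term {β t θ : ℝ} (hβ0 : 0 < β) (ht : 0 < t) (hθ : |θ| < π / 2)
    (hθβ : θ * (1 + β) = π * β) (k : ℕ) :
    ∫ u : ℝ, Complex.exp (β * u + θ * Complex.I) ^ (k + 1)
        * Complex.exp (-t * Complex.exp (u + (-θ : ℝ) * Complex.I))
      = Complex.exp ((π * (β * (k + 1)) : ℝ) * Complex.I)
        * ((1 / t) ^ (β * (k + 1)) * Real.Gamma (β * (k + 1)) : ℝ) := by
  rw [← integral_cexp_mul_cexp_neg_mul_exp_add_mul_I (y := -θ) (by positivity) ht (by simpa),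
    ← integral_const_mul]
  refine integral_congr_ae (.of_forall fun u => ?_)
  simp only
  rw [← Complex.exp_nat_mul, ← Complex.exp_add, ← Complex.exp_add, ← Complex.exp_add]
  congr 1
  have h : (θ : ℂ) * (1 + β) = π * β := by exact_mod_cast hθβ
  push_cast
  linear_combination (k + 1) * Complex.I * h

/-- The Wright-type density as a contour integral along a pair of conjugate rays. -/
theorem wrightG_eq_integral {β x t θ : ℝ} (hβ0 : 0 < β) (hβ1 : β < 1) (hx : 0 < x) (ht : 0 < t)
    (hθ : |θ| < π / 2) (hθβ : θ * (1 + β) = π * β) :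
    wrightG β x t = 1 / π * (∫ u : ℝ, wrightKernel β x θ u
      * Complex.exp (-t * Complex.exp (u + (-θ : ℝ) * Complex.I))).im := by
  have hcos : 0 < Real.cos θ := Real.cos_pos_of_mem_Ioo (abs_lt.1 hθ)
  set c := t * Real.cos θ with hc_def
  have hc : 0 < c := mul_pos ht hcos
  have hbound : ∀ u : ℝ, HasSum (fun k : ℕ => (x * Real.exp (β * u)) ^ k / (k.factorial : ℝ)
      * (Real.exp (β * u) * Real.exp (-c * Real.exp u)))
      (Real.exp (x * Real.exp (β * u)) * (Real.exp (β * u) * Real.exp (-c * Real.exp u))) :=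
    fun u => by
      have h := NormedSpace.expSeries_div_hasSum_exp (x * Real.exp (β * u))
      rw [← Real.exp_eq_exp_ℝ] at h
      exact h.mul_right _
  have hsum := hasSum_integral_of_dominated_convergence (μ := volume)
    (F := fun (k : ℕ) (u : ℝ) => ((-x) ^ k / (k.factorial : ℝ) : ℝ)
      * Complex.exp (β * u + θ * Complex.I) ^ (k + 1)
      * Complex.exp (-t * Complex.exp (u + (-θ : ℝ) * Complex.I)))
    (fun (k : ℕ) (u : ℝ) => (x * Real.exp (β * u)) ^ k / (k.factorial : ℝ)
      * (Real.exp (β * u) * Real.exp (-c * Real.exp u)))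
    (fun k => by fun_prop)
    (fun k => .of_forall fun u => by
      rw [norm_mul, norm_mul, norm_cexp_neg_mul_cexp, Complex.norm_real, norm_pow,
        Complex.norm_exp]
      simp only [norm_div, norm_pow, norm_neg, Real.norm_of_nonneg hx.le, RCLike.norm_natCast]
      refine le_of_eq ?_
      simp
      ring)
    (.of_forall fun u => (hbound u).summable)
    (by
      simp_rw [fun u => (hbound u).tsum_eq]
      obtain ⟨C, hC⟩ := exists_mul_exp_le_mul_exp_add hβ0 hβ1 hx (half_pos hc)
      refine ((integrable_exp_mul_exp_neg_mul_exp hβ0 (half_pos hc)).const_mul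
        (Real.exp C)).mono' (by fun_prop) (.of_forall fun u => ?_)
      rw [Real.norm_of_nonneg (by positivity), ← Real.exp_add, ← Real.exp_add, ← Real.exp_add,
        ← Real.exp_add]
      refine Real.exp_le_exp.2 ?_
      linarith [hC u])
    (.of_forall fun u => (hasSum_wrightKernel β x θ u).mul_right _)
  have him := (Complex.hasSum_im hsum).tsum_eq
  rw [← him, wrightG, ← tsum_mul_left, ← tsum_mul_left]
  refine tsum_congr fun k => ?_
  have ha : 0 < β * ((k : ℝ) + 1) := by positivity
  simp_rw [mul_assoc]
  rw [integral_const_mul, integral_wrightKernel_term hβ0 ht hθ hθβ, Complex.im_ofReal_mul,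
    mul_comm (Complex.exp _), Complex.im_ofReal_mul, Complex.exp_ofReal_mul_I_im,
    div_mul_eq_div_div, div_eq_mul_one_div _ (Real.Gamma _), one_div_Gamma_one_sub ha,
    one_div t, Real.inv_rpow ht.le, ← Real.rpow_neg ht.le,
    show -(β * ((k : ℝ) + 1)) = -β + -(β * k) by ring, Real.rpow_add ht, div_pow,
    ← Real.rpow_mul_natCast ht.le, Real.rpow_neg ht.le (β * k)]
  field_simp

theorem integral_exp_neg_mul_mul_wrightG {β x s θ : ℝ} (hβ0 : 0 < β) (hβ1 : β < 1) (hx : 0 < x)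
    (hs : 0 < s) (hθ : |θ| < π / 2) (hθβ : θ * (1 + β) = π * β) :
    ∫ t in Ioi (0 : ℝ), Real.exp (-s * t) * wrightG β x t = 1 / π * (∫ u : ℝ,
      wrightKernel β x θ u / (s + Complex.exp (u + (-θ : ℝ) * Complex.I))).im := by
  have hcos : 0 < Real.cos θ := Real.cos_pos_of_mem_Ioo (abs_lt.1 hθ)
  set f : ℝ → ℝ → ℂ := fun t u => wrightKernel β x θ u
    * Complex.exp (-(s + Complex.exp (u + (-θ : ℝ) * Complex.I)) * t) with hf
  have hre : ∀ u : ℝ, (-(s + Complex.exp (u + (-θ : ℝ) * Complex.I))).re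
      = -(s + Real.cos θ * Real.exp u) := fun u => by
    simp [Complex.exp_re]
    ring
  have hre_neg : ∀ u : ℝ, (-(s + Complex.exp (u + (-θ : ℝ) * Complex.I))).re < 0 := fun u => by
    rw [hre, neg_lt_zero]
    positivity
  have hnorm : ∀ t u : ℝ, ‖f t u‖
      = ‖wrightKernel β x θ u‖ * Real.exp (-(s + Real.cos θ * Real.exp u) * t) := fun t u => by
    rw [hf, norm_mul, Complex.norm_exp, Complex.re_mul_ofReal, hre]
  have hcont : Continuous (Function.uncurry f) := by
    have := continuous_wrightKernel β x θ
    unfold Function.uncurry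
    fun_prop
  have hint : Integrable (Function.uncurry f) ((volume.restrict (Ioi 0)).prod volume) := by
    rw [integrable_prod_iff' hcont.aestronglyMeasurable]
    refine ⟨.of_forall fun u => (integrableOn_exp_mul_complex_Ioi (hre_neg u) 0).const_mul
      (wrightKernel β x θ u), ?_⟩
    have hval : ∀ u : ℝ, ∫ t in Ioi (0 : ℝ), ‖f t u‖
        = ‖wrightKernel β x θ u‖ / (s + Real.cos θ * Real.exp u) := fun u => by
      simp_rw [hnorm]
      rw [integral_const_mul, integral_exp_mul_Ioi (by rw [← hre]; exact hre_neg u)]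
      rw [mul_zero, Real.exp_zero, neg_div_neg_eq, mul_one_div]
    simp_rw [Function.uncurry_apply_pair, hval]
    refine (integrable_exp_div_add_mul_exp hβ0 hβ1 hs hcos).mono' ?_ (.of_forall fun u => ?_)
    · refine Continuous.aestronglyMeasurable (Continuous.div
        (continuous_wrightKernel β x θ).norm (by fun_prop) fun u => ?_)
      positivity
    · rw [Real.norm_of_nonneg (by positivity)]
      gcongr
      exact norm_wrightKernel_le hx hθ u
  calc ∫ t in Ioi (0 : ℝ), Real.exp (-s * t) * wrightG β x t
      = ∫ t in Ioi (0 : ℝ), 1 / π * (∫ u : ℝ, f t u).im := by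
        refine setIntegral_congr_fun measurableSet_Ioi fun t ht => ?_
        rw [wrightG_eq_integral hβ0 hβ1 hx ht hθ hθβ, mul_left_comm, ← Complex.im_ofReal_mul,
          ← integral_const_mul]
        congr 3
        ext u
        simp only [hf]
        have h : Complex.exp (-(s + Complex.exp (u + (-θ : ℝ) * Complex.I)) * t)
            = Complex.exp (-s * t) * Complex.exp (-t * Complex.exp (u + (-θ : ℝ) * Complex.I)) := by
          rw [← Complex.exp_add]
          ring_nf
        rw [h, Complex.ofReal_exp, Complex.ofReal_mul, Complex.ofReal_neg]
        ring
    _ = 1 / π * (∫ t in Ioi (0 : ℝ), ∫ u : ℝ, f t u).im := by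
        rw [integral_const_mul]
        congr 1
        exact integral_im hint.integral_prod_left
    _ = _ := by
        rw [integral_integral_swap hint]
        congr 3
        ext u
        rw [hf, integral_const_mul, integral_exp_mul_complex_Ioi (hre_neg u)]
        simp only [Complex.ofReal_zero, mul_zero, Complex.exp_zero, neg_div_neg_eq]
        rw [mul_one_div]

theorem im_cexp_add_neg_mul_I_neg {θ : ℝ} (hθ0 : 0 < θ) (hθ : θ < π) (u : ℝ) :
    (Complex.exp (u + (-θ : ℝ) * Complex.I)).im < 0 := by
  have : 0 < Real.exp u * Real.sin θ :=
    mul_pos (Real.exp_pos u) (Real.sin_pos_of_pos_of_lt_pi hθ0 hθ)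
  simpa [Complex.exp_im] using this

theorem im_sub_div_add_pos {s : ℝ} (hs : 0 < s) {q : ℂ} (hq : q.im < 0) :
    0 < ((s - q) / (s + q)).im := by
  have hne : (s : ℂ) + q ≠ 0 := fun h => by
    have := congrArg Complex.im h
    simp at this
    linarith
  have h : 0 < Complex.normSq (s + q) := Complex.normSq_pos.2 hne
  rw [Complex.div_im, ← sub_div]
  refine div_pos ?_ h
  simp
  nlinarith

/-- The imaginary part of the integral of `2 s / (s ^ 2 - z ^ 2)` along a ray from `0` to `∞`
in the upper half plane is `π`. -/
theorem tendsto_im_integral_ray {s θ : ℝ} (hs : 0 < s) (hθ0 : 0 < θ) (hθ : θ < π) :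
    Tendsto (fun r : ℝ => (∫ u in -r..r, -(2 * s * Complex.exp (u + (-θ : ℝ) * Complex.I))
      / ((s - Complex.exp (u + (-θ : ℝ) * Complex.I))
        * (s + Complex.exp (u + (-θ : ℝ) * Complex.I)))).im) atTop (𝓝 π) := by
  set q : ℝ → ℂ := fun u => Complex.exp (u + (-θ : ℝ) * Complex.I) with hq
  have hqim : ∀ u, (q u).im < 0 := im_cexp_add_neg_mul_I_neg hθ0 hθ
  have hne₁ : ∀ u, (s : ℂ) + q u ≠ 0 := fun u h => by
    have := congrArg Complex.im h
    simp at this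
    linarith [hqim u]
  have hne₂ : ∀ u, (s : ℂ) - q u ≠ 0 := fun u h => by
    have := congrArg Complex.im h
    simp at this
    linarith [hqim u]
  have hqc : Continuous q := by fun_prop
  have hqd : ∀ u, HasDerivAt q (q u) u := fun u => by
    simpa [hq] using ((Complex.ofRealCLM.hasDerivAt (x := u)).add_const
      ((-θ : ℝ) * Complex.I)).cexp
  have hint : ∀ r : ℝ, ∫ u in -r..r, -(2 * s * q u) / ((s - q u) * (s + q u))
      = Complex.log ((s - q r) / (s + q r)) - Complex.log ((s - q (-r)) / (s + q (-r))) := by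
    intro r
    refine intervalIntegral.integral_eq_sub_of_hasDerivAt
      (f := fun u => Complex.log ((s - q u) / (s + q u))) (fun u _ => ?_)
      (Continuous.intervalIntegrable (Continuous.div (by fun_prop) (by fun_prop)
        fun u => mul_ne_zero (hne₂ u) (hne₁ u)) _ _)
    have hmem : (s - q u) / (s + q u) ∈ Complex.slitPlane :=
      Complex.mem_slitPlane_iff.2 (.inr (im_sub_div_add_pos hs (hqim u)).ne')
    have h1 := hne₁ u
    have h2 := hne₂ u
    refine ((((hqd u).const_sub (s : ℂ)).div ((hqd u).const_add (s : ℂ)) h1).clog_real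
      hmem).congr_deriv ?_
    rw [Pi.div_apply]
    field_simp
    ring
  have hq0 : Tendsto (fun u => q (-u)) atTop (𝓝 0) := by
    rw [tendsto_zero_iff_norm_tendsto_zero]
    simpa [hq, Complex.norm_exp] using Real.tendsto_exp_neg_atTop_nhds_zero
  have hqinv : Tendsto (fun u => (q u)⁻¹) atTop (𝓝 0) := by
    rw [tendsto_zero_iff_norm_tendsto_zero]
    simpa [hq, Complex.norm_exp, ← Real.exp_neg] using Real.tendsto_exp_neg_atTop_nhds_zero
  have hs' : (s : ℂ) ≠ 0 := by exact_mod_cast hs.ne'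
  have hbot : Tendsto (fun u => ((s - q (-u)) / (s + q (-u)))) atTop (𝓝 1) := by
    have h := (hq0.const_sub (s : ℂ)).div (hq0.const_add (s : ℂ)) (by simpa using hs')
    rwa [sub_zero, add_zero, div_self hs'] at h
  have htop : Tendsto (fun u => ((s - q u) / (s + q u))) atTop (𝓝 (-1)) := by
    have h := ((hqinv.const_mul (s : ℂ)).sub_const 1).div ((hqinv.const_mul (s : ℂ)).add_const 1)
      (by simp)
    simp only [mul_zero, zero_sub, zero_add, div_one] at h
    refine h.congr fun u => ?_
    have h0 : q u ≠ 0 := Complex.exp_ne_zero _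
    have h1 := hne₁ u
    simp only [Pi.div_apply]
    field_simp
  have harg_bot : Tendsto (fun u => ((s - q (-u)) / (s + q (-u))).arg) atTop (𝓝 0) := by
    have h := (Complex.continuousAt_arg (x := 1) (by simp)).tendsto.comp hbot
    rwa [Complex.arg_one] at h
  have harg_top : Tendsto (fun u => ((s - q u) / (s + q u)).arg) atTop (𝓝 π) :=
    (Complex.tendsto_arg_nhdsWithin_im_nonneg_of_re_neg_of_im_zero (z := -1) (by simp)
      (by simp)).comp (tendsto_nhdsWithin_iff.2
        ⟨htop, .of_forall fun u => (im_sub_div_add_pos hs (hqim u)).le⟩)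
  have h := harg_top.sub harg_bot
  rw [sub_zero] at h
  refine h.congr fun r => ?_
  rw [← Complex.log_im, ← Complex.log_im, ← Complex.sub_im, ← hint]

theorem cexp_ne_cexp_of_abs_im_lt {z w : ℂ} (hz : |z.im| < π) (hw : w.im = 0) (hne : z ≠ w) :
    Complex.exp z ≠ Complex.exp w := fun h => hne <|
  Complex.exp_inj_of_neg_pi_lt_of_le_pi (abs_lt.1 hz).1 (abs_lt.1 hz).2.le
    (by rw [hw]; linarith [pi_pos]) (by rw [hw]; exact pi_pos.le) h

/-- A function vanishing at the real point `Real.log s` is divisible by `s - exp z` on the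
strip `|im z| < π`. -/
theorem exists_differentiableOn_div_sub_cexp {s : ℝ} (hs : 0 < s) {N : ℂ → ℂ}
    (hN : DifferentiableOn ℂ N {z | |z.im| < π}) (hN0 : N (Real.log s) = 0) :
    ∃ H : ℂ → ℂ, DifferentiableOn ℂ H {z | |z.im| < π} ∧
      ∀ z : ℂ, z ≠ (Real.log s : ℝ) → H z = N z / (s - Complex.exp z) := by
  have hexp : Complex.exp (Real.log s) = s := by
    rw [← Complex.ofReal_exp, Real.exp_log hs]
  have hU : {z : ℂ | |z.im| < π} ∈ 𝓝 ((Real.log s : ℝ) : ℂ) :=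
    (isOpen_lt (by fun_prop) (by fun_prop)).mem_nhds (by simpa using pi_pos)
  refine ⟨fun z => -(dslope N (Real.log s) z / dslope Complex.exp (Real.log s) z), ?_, ?_⟩
  · refine (((Complex.differentiableOn_dslope hU).2 hN).div
      ((Complex.differentiableOn_dslope hU).2 Complex.differentiable_exp.differentiableOn)
      fun z hz => ?_).neg
    by_cases h : z = Real.log s
    · rw [h, dslope_same, Complex.deriv_exp]
      exact Complex.exp_ne_zero _
    · rw [dslope_of_ne _ h, slope_def_field]
      exact div_ne_zero (sub_ne_zero.2 (cexp_ne_cexp_of_abs_im_lt hz (Complex.ofReal_im _) h))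
        (sub_ne_zero.2 h)
  · intro z h
    have h' := sub_ne_zero.2 h
    simp only [dslope_of_ne _ h, slope_def_field, hN0, hexp, sub_zero]
    rw [div_div_div_cancel_right₀ h', ← div_neg, neg_sub]

/-- The residue at `s` of `z ^ β * exp (-x * z ^ β) / (z * (s - z))`, picked up by the pair of
conjugate rays. -/
theorem im_integral_wrightKernel_div {β x s θ : ℝ} (hβ0 : 0 < β) (hβ1 : β < 1) (hx : 0 < x)
    (hs : 0 < s) (hθ0 : 0 < θ) (hθ : θ < π / 2) (hθβ : θ * (1 + β) = π * β) :
    (∫ u : ℝ, wrightKernel β x θ u / (s + Complex.exp (u + (-θ : ℝ) * Complex.I))).im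
      = s ^ (β - 1) * Real.exp (-x * s ^ β) * π := by
  have habs : |θ| < π / 2 := by rwa [abs_of_pos hθ0]
  have hcos : 0 < Real.cos θ := Real.cos_pos_of_mem_Ioo (abs_lt.1 habs)
  set K := s ^ (β - 1) * Real.exp (-x * s ^ β) with hK
  have hK0 : 0 < K := by positivity
  have hφ0 : 0 < π - θ := by linarith
  have hβφ : β * (π - θ) = θ := by linarith
  have hexp : Complex.exp (Real.log s) = s := by
    rw [← Complex.ofReal_exp, Real.exp_log hs]
  have hadd_ne : ∀ z : ℂ, |z.im| < π → (s : ℂ) + Complex.exp z ≠ 0 := fun z hz h => by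
    have hpi : (Real.log s + π * Complex.I : ℂ).im = π := by simp
    have h1 : Complex.exp z = Complex.exp (Real.log s + π * Complex.I) := by
      rw [Complex.exp_add, Complex.exp_pi_mul_I, hexp]
      linear_combination h
    have h2 := Complex.exp_inj_of_neg_pi_lt_of_le_pi (abs_lt.1 hz).1 (abs_lt.1 hz).2.le
      (by rw [hpi]; linarith [pi_pos]) hpi.le h1
    rw [h2, hpi, abs_of_pos pi_pos] at hz
    exact lt_irrefl _ hz
  set N : ℂ → ℂ := fun z => Complex.exp (β * z) * Complex.exp (-x * Complex.exp (β * z))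
    - K * (2 * s * Complex.exp z / (s + Complex.exp z)) with hN
  have hs' : (s : ℂ) ≠ 0 := by exact_mod_cast hs.ne'
  have hN0 : N (Real.log s) = 0 := by
    have h1 : Complex.exp (β * Real.log s) = ((s ^ β : ℝ) : ℂ) := by
      rw [Real.rpow_def_of_pos hs]
      push_cast
      ring_nf
    have h2 : ((s ^ β : ℝ) : ℂ) = (s ^ (β - 1) : ℝ) * s := by
      rw [← Complex.ofReal_mul, ← Real.rpow_add_one hs.ne', sub_add_cancel]
    have h3 : 2 * (s : ℂ) * s / (s + s) = s := by
      rw [← two_mul]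
      field_simp
    simp only [hN]
    rw [hexp, h1, h3, hK]
    push_cast
    linear_combination Complex.exp (-x * ((s ^ β : ℝ) : ℂ)) * h2
  obtain ⟨H, hHd, hH⟩ := exists_differentiableOn_div_sub_cexp hs (N := N)
    (DifferentiableOn.sub (by fun_prop) (DifferentiableOn.const_mul
      (DifferentiableOn.div (by fun_prop) (by fun_prop) fun z hz => hadd_ne z hz) _)) hN0
  have hstrip : ∀ y ∈ [[0, π - θ]], 0 ≤ y ∧ y ≤ π - θ := fun y hy => by
    rwa [uIcc_of_le hφ0.le] at hy
  set b : ℝ → ℝ := fun r => (Real.exp (β * r) + K * (2 * s * Real.exp r / |s - Real.exp r|))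
    / |s - Real.exp r| with hb
  have hbound : ∀ r : ℝ, r ≠ Real.log s → ∀ y ∈ [[0, π - θ]],
      ‖H ((r : ℝ) + (y : ℝ) * Complex.I)‖ ≤ b r := fun r hr y hy => by
    obtain ⟨hy0, hy1⟩ := hstrip y hy
    have hpos : 0 < |s - Real.exp r| := by
      rw [abs_pos, sub_ne_zero]
      rintro rfl
      simp at hr
    have hnorm : ‖Complex.exp ((r : ℝ) + (y : ℝ) * Complex.I)‖ = Real.exp r := by
      simp [Complex.norm_exp]
    rw [hH _ (fun h => hr (by simpa using congrArg Complex.re h)), norm_div]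
    have hsub : |s - Real.exp r| ≤ ‖s - Complex.exp ((r : ℝ) + (y : ℝ) * Complex.I)‖ := by
      have := abs_norm_sub_norm_le (s : ℂ) (Complex.exp ((r : ℝ) + (y : ℝ) * Complex.I))
      rwa [hnorm, Complex.norm_of_nonneg hs.le] at this
    have hadd : |s - Real.exp r| ≤ ‖s + Complex.exp ((r : ℝ) + (y : ℝ) * Complex.I)‖ := by
      have := abs_norm_sub_norm_le (s : ℂ) (-Complex.exp ((r : ℝ) + (y : ℝ) * Complex.I))
      rwa [norm_neg, hnorm, Complex.norm_of_nonneg hs.le, sub_neg_eq_add] at this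
    have hker : ‖Complex.exp (β * ((r : ℝ) + (y : ℝ) * Complex.I))
        * Complex.exp (-x * Complex.exp (β * ((r : ℝ) + (y : ℝ) * Complex.I)))‖
        ≤ Real.exp (β * r) := by
      have h := norm_wrightKernel_le (β := β) (θ := β * y) hx (by
        rw [abs_of_nonneg (by positivity)]
        nlinarith) r
      rw [wrightKernel] at h
      convert h using 3 <;> push_cast <;> ring_nf
    rw [hb, hN]
    refine div_le_div₀ (by positivity) ((norm_sub_le _ _).trans (add_le_add hker ?_)) hpos hsub
    rw [norm_mul, norm_div, norm_mul, norm_mul, hnorm, Complex.norm_of_nonneg hK0.le,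
      Complex.norm_of_nonneg hs.le, Complex.norm_ofNat]
    gcongr
  have hb_top : Tendsto b atTop (𝓝 0) := by
    have h1 : Tendsto (fun r : ℝ => Real.exp (-r)) atTop (𝓝 0) :=
      Real.tendsto_exp_neg_atTop_nhds_zero
    have h2 : Tendsto (fun r : ℝ => Real.exp ((β - 1) * r)) atTop (𝓝 0) :=
      Real.tendsto_exp_atBot.comp (tendsto_id.const_mul_atTop_of_neg (by linarith))
    have h3 : Tendsto (fun r : ℝ => |s * Real.exp (-r) - 1|) atTop (𝓝 1) := by
      simpa using ((h1.const_mul s).sub_const 1).abs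
    have h4 := (h2.add ((((h1.const_mul (2 * s)).div h3 one_ne_zero).const_mul K))).div h3
      one_ne_zero
    simp only [mul_zero, zero_div, add_zero] at h4
    refine h4.congr fun r => ?_
    have h5 : |s - Real.exp r| = Real.exp r * |s * Real.exp (-r) - 1| := by
      rw [← abs_of_pos (Real.exp_pos r), ← abs_mul, abs_of_pos (Real.exp_pos r), mul_sub,
        mul_left_comm, ← Real.exp_add]
      simp
    have h6 : Real.exp (β * r) = Real.exp r * Real.exp ((β - 1) * r) := by
      rw [← Real.exp_add]
      ring_nf
    simp only [hb, Pi.div_apply]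
    rw [h5, h6, Real.exp_neg]
    have := Real.exp_pos r
    field_simp
  have hb_bot : Tendsto b atBot (𝓝 0) := by
    have h1 : Tendsto (fun r : ℝ => Real.exp (β * r)) atBot (𝓝 0) :=
      Real.tendsto_exp_atBot.comp (tendsto_id.const_mul_atBot hβ0)
    have h2 : Tendsto (fun r : ℝ => |s - Real.exp r|) atBot (𝓝 s) := by
      simpa [abs_of_pos hs] using (Real.tendsto_exp_atBot.const_sub s).abs
    have h3 := (h1.add ((((Real.tendsto_exp_atBot.const_mul (2 * s)).div h2 hs.ne').const_mul
      K))).div h2 hs.ne'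
    simp only [mul_zero, zero_div, add_zero] at h3
    exact h3
  have hlim := tendsto_integral_sub_integral_add_mul_I (η := π - θ)
    (hHd.mono fun z hz => by
      obtain ⟨h0, h1⟩ := hstrip _ hz
      rw [Set.mem_ofPred_eq, abs_of_nonneg h0]
      linarith)
    ((eventually_gt_atTop (Real.log s)).mono fun r hr => hbound r hr.ne')
    ((eventually_lt_atBot (Real.log s)).mono fun r hr => hbound r hr.ne) hb_top hb_bot
  have hreal : ∀ r : ℝ, (∫ u in -r..r, H (u : ℝ)).im = 0 := fun r => by
    have h : ∫ u in -r..r, H (u : ℝ) = ∫ u in -r..r, (((H (u : ℝ)).re : ℝ) : ℂ) := by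
      refine intervalIntegral.integral_congr_ae ?_
      filter_upwards [compl_mem_ae_iff.2 (measure_singleton (Real.log s))] with u hu _
      refine Complex.ext (by simp) ?_
      rw [hH u (by simpa using hu), Complex.ofReal_im]
      have h1 : N u / (s - Complex.exp u) = (((Real.exp (β * u) * Real.exp (-x * Real.exp (β * u))
          - K * (2 * s * Real.exp u / (s + Real.exp u))) / (s - Real.exp u) : ℝ) : ℂ) := by
        simp only [hN]
        push_cast
        rfl
      rw [h1, Complex.ofReal_im]
    rw [h, intervalIntegral.integral_ofReal, Complex.ofReal_im]
  have hexpφ : ∀ u : ℝ, Complex.exp (u + (π - θ : ℝ) * Complex.I)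
      = -Complex.exp (u + (-θ : ℝ) * Complex.I) := fun u => by
    rw [← mul_neg_one, ← Complex.exp_pi_mul_I, ← Complex.exp_add]
    push_cast
    ring_nf
  have hqim := im_cexp_add_neg_mul_I_neg hθ0 (by linarith : θ < π)
  have hne₁ : ∀ u : ℝ, (s : ℂ) + Complex.exp (u + (-θ : ℝ) * Complex.I) ≠ 0 := fun u h => by
    have := congrArg Complex.im h
    rw [Complex.add_im, Complex.ofReal_im, Complex.zero_im] at this
    linarith [hqim u]
  have hne₂ : ∀ u : ℝ, (s : ℂ) - Complex.exp (u + (-θ : ℝ) * Complex.I) ≠ 0 := fun u h => by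
    have := congrArg Complex.im h
    rw [Complex.sub_im, Complex.ofReal_im, Complex.zero_im] at this
    linarith [hqim u]
  have hHφ : ∀ u : ℝ, H (u + (π - θ : ℝ) * Complex.I)
      = wrightKernel β x θ u / (s + Complex.exp (u + (-θ : ℝ) * Complex.I))
        - K * (-(2 * s * Complex.exp (u + (-θ : ℝ) * Complex.I))
          / ((s - Complex.exp (u + (-θ : ℝ) * Complex.I))
            * (s + Complex.exp (u + (-θ : ℝ) * Complex.I)))) := fun u => by
    have hne : (u : ℂ) + (π - θ : ℝ) * Complex.I ≠ Real.log s := fun h => by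
      have := congrArg Complex.im h
      simp at this
      linarith
    have hβz : (β : ℂ) * (u + (π - θ : ℝ) * Complex.I) = β * u + θ * Complex.I := by
      have : (β : ℂ) * (π - θ : ℝ) = θ := by exact_mod_cast hβφ
      linear_combination Complex.I * this
    rw [hH _ hne]
    simp only [hN]
    rw [hβz, hexpφ, ← wrightKernel, sub_neg_eq_add, ← sub_eq_add_neg, sub_div, mul_neg,
      mul_div_assoc, div_div]
  have hcont₁ : Continuous fun u : ℝ =>
      wrightKernel β x θ u / (s + Complex.exp (u + (-θ : ℝ) * Complex.I)) :=
    (continuous_wrightKernel β x θ).div (by fun_prop) hne₁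
  have hcont₂ : Continuous fun u : ℝ => -(2 * s * Complex.exp (u + (-θ : ℝ) * Complex.I))
      / ((s - Complex.exp (u + (-θ : ℝ) * Complex.I))
        * (s + Complex.exp (u + (-θ : ℝ) * Complex.I))) :=
    Continuous.div (by fun_prop) (by fun_prop) fun u => mul_ne_zero (hne₂ u) (hne₁ u)
  have hint : Integrable fun u : ℝ =>
      wrightKernel β x θ u / (s + Complex.exp (u + (-θ : ℝ) * Complex.I)) := by
    refine (integrable_exp_div_add_mul_exp hβ0 hβ1 hs hcos).mono' hcont₁.aestronglyMeasurable
      (.of_forall fun u => ?_)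
    rw [norm_div]
    refine div_le_div₀ (Real.exp_pos _).le (norm_wrightKernel_le hx habs u) (by positivity) ?_
    refine le_trans (le_of_eq ?_) (Complex.re_le_norm _)
    simp [Complex.exp_re]
    ring
  have hlim₁ := (Complex.continuous_im.tendsto _).comp
    (intervalIntegral_tendsto_integral hint tendsto_neg_atTop_atBot tendsto_id)
  have hlim₂ := (tendsto_im_integral_ray hs hθ0 (by linarith : θ < π)).const_mul K
  have hlim₃ := (Complex.continuous_im.tendsto _).comp hlim
  refine sub_eq_zero.1 (tendsto_nhds_unique (hlim₁.sub hlim₂) ?_)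
  rw [Complex.zero_im, ← neg_zero] at hlim₃
  have hlim₄ := hlim₃.neg
  rw [neg_neg] at hlim₄
  refine hlim₄.congr fun r => ?_
  simp only [Function.comp_apply, Complex.sub_im, hreal, hHφ, zero_sub, neg_neg, id]
  rw [intervalIntegral.integral_sub (hcont₁.intervalIntegrable _ _)
    ((hcont₂.const_mul _).intervalIntegrable _ _), intervalIntegral.integral_const_mul,
    Complex.sub_im, Complex.im_ofReal_mul]

/-- Laplace transform of `t ↦ g_β(x;t)`:
`∫_0^∞ e^{−s t} g_β(x;t) dt = s^{β−1} e^{−x s^β}`. -/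
theorem wrightG_laplace_time_arg (β x s : ℝ) (hβ0 : 0 < β) (hβ1 : β < 1)
    (hx : 0 < x) (hs : 0 < s) :
    ∫ t in Set.Ioi (0:ℝ), Real.exp (-s * t) * wrightG β x t
      = s ^ (β - 1) * Real.exp (-x * s ^ β) := by
  have hpos : 0 < 1 + β := by linarith
  set θ := π * β / (1 + β) with hθ
  have hθ0 : 0 < θ := by positivity
  have hθβ : θ * (1 + β) = π * β := div_mul_cancel₀ _ hpos.ne'
  have hθ1 : θ < π / 2 := by
    rw [hθ, div_lt_div_iff₀ hpos two_pos]
    nlinarith [pi_pos]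
  rw [integral_exp_neg_mul_mul_wrightG hβ0 hβ1 hx hs (by rwa [abs_of_pos hθ0]) hθβ,
    im_integral_wrightKernel_div hβ0 hβ1 hx hs hθ0 hθ1 hθβ]
  field_simp
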